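/- For real random variables f, f̃, g, g̃ on a finite probability space with p := E[f² + g²] > 0, p̃ := E[f̃² + g̃²] > 0, the fidelity F := E[f f̃ + g g̃]/√(p p̃) satisfies F ≥ (1 + E[(f̃−f)f + (g̃−g)g]/p)·(1 − (p̃−p)/(2p)), provided 1 + E[(f̃−f)f + (g̃−g)g]/p ≥ 0. -/

import Mathlib

open Finset

/-- The tangent line of `1 / √(1 + x)` at `0` lies below the graph. -/
theorem one_sub_half_le_one_div_sqrt_one_add {x : ℝ} (hx : -1 < x) :
    1 - x / 2 ≤ 1 / √(1 + x) := by
  have hs : 0 < √(1 + x) := Real.sqrt_pos.2 (by linarith)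
  have hsq : √(1 + x) ^ 2 = 1 + x := Real.sq_sqrt (by linarith)
  rw [le_div_iff₀ hs]
  have hx' : x = √(1 + x) ^ 2 - 1 := by linarith
  generalize √(1 + x) = s at *
  subst hx'
  nlinarith [mul_nonneg (sq_nonneg (s - 1)) (by linarith : 0 ≤ s + 2)]

theorem hhl_fidelity_lower_bound {Ω : Type*} [Fintype Ω]
    (w : Ω → ℝ) (hw : ∀ ω, 0 ≤ w ω) (hsum : ∑ ω, w ω = 1)
    (f ft g gt : Ω → ℝ)
    (hp : 0 < ∑ ω, w ω * (f ω ^ 2 + g ω ^ 2))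
    (hpt : 0 < ∑ ω, w ω * (ft ω ^ 2 + gt ω ^ 2))
    (hD : 0 ≤ 1 + (∑ ω, w ω * ((ft ω - f ω) * f ω + (gt ω - g ω) * g ω)) /
        (∑ ω, w ω * (f ω ^ 2 + g ω ^ 2))) :
    (∑ ω, w ω * (f ω * ft ω + g ω * gt ω)) /
        Real.sqrt ((∑ ω, w ω * (f ω ^ 2 + g ω ^ 2)) *
          (∑ ω, w ω * (ft ω ^ 2 + gt ω ^ 2))) ≥
      (1 + (∑ ω, w ω * ((ft ω - f ω) * f ω + (gt ω - g ω) * g ω)) /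
          (∑ ω, w ω * (f ω ^ 2 + g ω ^ 2))) *
      (1 - ((∑ ω, w ω * (ft ω ^ 2 + gt ω ^ 2)) - (∑ ω, w ω * (f ω ^ 2 + g ω ^ 2))) /
          (2 * ∑ ω, w ω * (f ω ^ 2 + g ω ^ 2))) := by
  have hN : ∑ ω, w ω * (f ω * ft ω + g ω * gt ω) =
      (∑ ω, w ω * (f ω ^ 2 + g ω ^ 2)) +
        ∑ ω, w ω * ((ft ω - f ω) * f ω + (gt ω - g ω) * g ω) := by
    rw [← sum_add_distrib]
    exact sum_congr rfl fun ω _ => by ring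
  rw [hN]
  generalize ∑ ω, w ω * (f ω ^ 2 + g ω ^ 2) = p at *
  generalize ∑ ω, w ω * (ft ω ^ 2 + gt ω ^ 2) = q at *
  generalize ∑ ω, w ω * ((ft ω - f ω) * f ω + (gt ω - g ω) * g ω) = d at *
  have hx : 1 + (q - p) / p = q / p := by field_simp; ring
  have hlt : -1 < (q - p) / p := by linarith [div_pos hpt hp]
  have key := one_sub_half_le_one_div_sqrt_one_add hlt
  have hsqrt : √(p * q) = p * √(q / p) := by
    rw [show p * q = p ^ 2 * (q / p) by field_simp, Real.sqrt_mul (sq_nonneg p),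
      Real.sqrt_sq hp.le]
  have hs : 0 < √(q / p) := Real.sqrt_pos.2 (div_pos hpt hp)
  rw [hx] at key
  calc (1 + d / p) * (1 - (q - p) / (2 * p))
      = (1 + d / p) * (1 - (q - p) / p / 2) := by rw [div_div, mul_comm p 2]
    _ ≤ (1 + d / p) * (1 / √(q / p)) := mul_le_mul_of_nonneg_left key hD
    _ = (p + d) / √(p * q) := by
      rw [hsqrt]
      generalize √(q / p) = s at *
      field_simp
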